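/- Let m>1, 0<p<1 with m+p>2, σ>2(1−p)/(m−1). There exists Ξ>0 such that for every ξ₀∈(Ξ,∞): the solution f of the profile ODE having an interface of Type I at ξ₀, extended backward from ξ₀ on its maximal interval of positivity, has a backward change of sign at some point ξ₁∈(0,ξ₀), i.e. f(ξ₁)=0, the one-sided derivative (f^m)'(ξ₁⁺)>0, and f>0 on (ξ₁,ξ₀). -/

import Mathlib

open Real Filter Set Topology

/-- The function `f^m` (real power). -/
noncomputable def Fm (m : ℝ) (f : ℝ → ℝ) : ℝ → ℝ := fun ξ => f ξ ^ m

/-- `f` solves the self-similar profile ODE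
`(f^m)'' - α f + β ξ f' + ξ^σ f^p = 0` on the set `S`. -/
noncomputable def SolvesODE (m p σ α β : ℝ) (f : ℝ → ℝ) (S : Set ℝ) : Prop :=
  ∀ ξ ∈ S,
    deriv (deriv (Fm m f)) ξ - α * f ξ + β * ξ * deriv f ξ + ξ ^ σ * f ξ ^ p = 0

/-- A profile: continuous and nonnegative on `[0,∞)`, with `f^m` of class `C²`
on the (positive-space) positivity set, solving the profile ODE there. -/
noncomputable def IsProfile (m p σ α β : ℝ) (f : ℝ → ℝ) : Prop :=
  ContinuousOn f (Set.Ici 0) ∧ (∀ ξ ∈ Set.Ici (0 : ℝ), 0 ≤ f ξ) ∧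
    ContDiffOn ℝ 2 (Fm m f) {ξ : ℝ | 0 < ξ ∧ 0 < f ξ} ∧
    SolvesODE m p σ α β f {ξ : ℝ | 0 < ξ ∧ 0 < f ξ}

/-- Behavior (P1) at the origin: `f(0) = a > 0`, `f'(0) = 0`. -/
noncomputable def GoodP1 (f : ℝ → ℝ) : Prop :=
  0 < f 0 ∧ HasDerivWithinAt f 0 (Set.Ici 0) 0

/-- Behavior (P2) at the origin: `f(0) = 0`, `(f^m)'(0) = 0`. -/
noncomputable def GoodP2 (m : ℝ) (f : ℝ → ℝ) : Prop :=
  f 0 = 0 ∧ HasDerivWithinAt (Fm m f) 0 (Set.Ici 0) 0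

/-- `f` has an interface at `ξ₀ ∈ (0,∞)`: `f(ξ₀) = 0`, `(f^m)'(ξ₀) = 0`, and
`f > 0` on a left-neighborhood of `ξ₀`. -/
noncomputable def HasInterface (m : ℝ) (f : ℝ → ℝ) (ξ₀ : ℝ) : Prop :=
  0 < ξ₀ ∧ f ξ₀ = 0 ∧ HasDerivAt (Fm m f) 0 ξ₀ ∧
    ∃ δ > 0, ∀ ξ ∈ Set.Ioo (ξ₀ - δ) ξ₀, 0 < f ξ

/-- Type I interface behavior at `ξ₀`: `f(ξ)(ξ₀-ξ)^{-1/(m-1)}` has a finite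
positive limit as `ξ → ξ₀⁻`. -/
noncomputable def TypeI (m : ℝ) (f : ℝ → ℝ) (ξ₀ : ℝ) : Prop :=
  ∃ L > 0, Filter.Tendsto (fun ξ => f ξ * (ξ₀ - ξ) ^ (-(1 / (m - 1))))
    (nhdsWithin ξ₀ (Set.Iio ξ₀)) (nhds L)

/-- Type II interface behavior at `ξ₀`: `f(ξ)(ξ₀-ξ)^{-1/(1-p)}` has a finite
positive limit as `ξ → ξ₀⁻`. -/
noncomputable def TypeII (p : ℝ) (f : ℝ → ℝ) (ξ₀ : ℝ) : Prop :=
  ∃ L > 0, Filter.Tendsto (fun ξ => f ξ * (ξ₀ - ξ) ^ (-(1 / (1 - p))))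
    (nhdsWithin ξ₀ (Set.Iio ξ₀)) (nhds L)

/-- If `W` is a derivative which, at every point, either is locally stationary or agrees with the
continuous function `q`, then `W` is constant on `[x, y]` or its left value is a value of `q`. -/
lemma eq_or_exists_eq_left {P W q : ℝ → ℝ} {x y : ℝ} (hxy : x ≤ y)
    (hP : ∀ z ∈ Icc x y, HasDerivAt P (W z) z) (hq : ∀ z ∈ Icc x y, ContinuousAt q z)
    (hW : ∀ z ∈ Icc x y, HasDerivAt W 0 z ∨ W z = q z) :
    W x = W y ∨ ∃ s ∈ Icc x y, W x = q s := by
  by_cases hS : ∃ z ∈ Icc x y, W z = q z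
  swap
  · left
    push Not at hS
    have hd : ∀ z ∈ Icc x y, HasDerivAt W 0 z := fun z hz => (hW z hz).resolve_right (hS z hz)
    exact (constant_of_has_deriv_right_zero (fun z hz => (hd z hz).continuousAt.continuousWithinAt)
      (fun z hz => (hd z (Ico_subset_Icc_self hz)).hasDerivWithinAt) y ⟨hxy, le_rfl⟩).symm
  right
  set S : Set ℝ := {z | z ∈ Icc x y ∧ W z = q z} with hSdef
  have hSne : S.Nonempty := let ⟨z, hz, h⟩ := hS; ⟨z, hz, h⟩
  have hSbdd : BddBelow S := ⟨x, fun z hz => hz.1.1⟩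
  set s := sInf S with hs
  have hxs : x ≤ s := le_csInf hSne fun z hz => hz.1.1
  have hsy : s ≤ y := by
    obtain ⟨z, hz⟩ := hSne
    exact (csInf_le hSbdd hz).trans hz.1.2
  have hsI : s ∈ Icc x y := ⟨hxs, hsy⟩
  have hd : ∀ z ∈ Ico x s, HasDerivAt W 0 z := fun z hz =>
    (hW z ⟨hz.1, hz.2.le.trans hsy⟩).resolve_right fun h =>
      absurd (csInf_le hSbdd (show z ∈ S from ⟨⟨hz.1, hz.2.le.trans hsy⟩, h⟩)) (not_le.2 hz.2)
  have hsS : W s = q s := by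
    by_contra hne
    have hWd := (hW s hsI).resolve_right hne
    have hev : ∀ᶠ z in 𝓝 s, W z ≠ q z := by
      have := (hWd.continuousAt.sub (hq s hsI)).eventually_ne (sub_ne_zero.2 hne)
      filter_upwards [this] with z hz using sub_ne_zero.1 hz
    obtain ⟨ε, hε, hball⟩ := Metric.eventually_nhds_iff.1 hev
    obtain ⟨z, hzS, hz⟩ := exists_lt_of_csInf_lt hSne (show sInf S < s + ε by linarith)
    have hsz : s ≤ z := csInf_le hSbdd hzS
    refine hball (y := z) ?_ hzS.2
    rw [Real.dist_eq, abs_of_nonneg (by linarith)]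
    linarith
  refine ⟨s, hsI, ?_⟩
  rcases hxs.eq_or_lt with h | h
  · rw [← hsS, ← h]
  rw [← hsS]
  have hconst : ∀ z ∈ Ico x s, W z = W x := by
    intro z hz
    exact constant_of_has_deriv_right_zero (a := x) (b := z)
      (fun t ht => (hd t ⟨ht.1, ht.2.trans_lt hz.2⟩).continuousAt.continuousWithinAt)
      (fun t ht => (hd t ⟨ht.1, ht.2.trans hz.2⟩).hasDerivWithinAt) z ⟨hz.1, le_rfl⟩
  have hlim : Tendsto (fun z => deriv P z) (𝓝[<] s) (𝓝 (W x)) := by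
    refine Tendsto.congr' ?_ tendsto_const_nhds
    filter_upwards [Ioo_mem_nhdsLT h] with z hz
    rw [(hP z ⟨hz.1.le, hz.2.le.trans hsy⟩).deriv, hconst z ⟨hz.1.le, hz.2⟩]
  have h1 := hasDerivWithinAt_Iic_of_tendsto_deriv (s := Ioo x s) (a := s) (f := P)
    (fun z hz => (hP z ⟨hz.1.le, hz.2.le.trans hsy⟩).differentiableAt.differentiableWithinAt)
    (hP s hsI).continuousAt.continuousWithinAt (Ioo_mem_nhdsLT h) hlim
  exact (uniqueDiffWithinAt_Iic s).eq_deriv _ h1 (hP s hsI).hasDerivWithinAt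

lemma eq_or_exists_eq {P W q : ℝ → ℝ} {x y : ℝ} (hxy : x ≤ y)
    (hP : ∀ z ∈ Icc x y, HasDerivAt P (W z) z) (hq : ∀ z ∈ Icc x y, ContinuousAt q z)
    (hW : ∀ z ∈ Icc x y, HasDerivAt W 0 z ∨ W z = q z) :
    W x = W y ∨ ∃ s ∈ Icc x y, ∃ t ∈ Icc x y, W x = q s ∧ W y = q t := by
  rcases eq_or_exists_eq_left hxy hP hq hW with h | ⟨s, hs, hxs⟩
  · exact Or.inl h
  have hmem : ∀ z ∈ Icc (-y) (-x), -z ∈ Icc x y := fun z hz =>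
    ⟨by linarith [hz.2], by linarith [hz.1]⟩
  have key := eq_or_exists_eq_left (P := fun z => -P (-z)) (W := fun z => W (-z))
    (q := fun z => q (-z)) (neg_le_neg hxy)
    (fun z hz => by
      refine ((hP (-z) (hmem z hz)).scomp z (hasDerivAt_neg z)).neg.congr_deriv ?_
      simp)
    (fun z hz => ContinuousAt.comp (hq (-z) (hmem z hz)) continuous_neg.continuousAt)
    (fun z hz => by
      refine (hW (-z) (hmem z hz)).imp (fun h => ?_) id
      have := h.scomp z (hasDerivAt_neg z)
      simpa [Function.comp_def] using this)
  simp only [neg_neg] at key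
  rcases key with h | ⟨t, ht, h⟩
  · exact Or.inl h.symm
  · exact Or.inr ⟨s, hs, -t, hmem t ht, hxs, h⟩

/-- A derivative `W` which agrees with `q` wherever it fails to be stationary is constant,
provided `q` is `C¹` as soon as `W` is continuous. -/
lemma derivative_constant_of_stationary_or_eq {P W q : ℝ → ℝ} {a b : ℝ}
    (hP : ∀ z ∈ Ioo a b, HasDerivAt P (W z) z) (hq : ∀ z ∈ Ioo a b, ContinuousAt q z)
    (hW : ∀ z ∈ Ioo a b, HasDerivAt W 0 z ∨ (¬ DifferentiableAt ℝ W z ∧ W z = q z))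
    (hqW : (∀ z ∈ Ioo a b, ContinuousAt W z) → ContDiffOn ℝ 1 q (Ioo a b)) :
    ∀ x ∈ Ioo a b, ∀ y ∈ Ioo a b, W x = W y := by
  have hsub : ∀ {x y : ℝ}, x ∈ Ioo a b → y ∈ Ioo a b → Icc x y ⊆ Ioo a b := fun hx hy z hz =>
    ⟨hx.1.trans_le hz.1, hz.2.trans_lt hy.2⟩
  have hW' : ∀ z ∈ Ioo a b, HasDerivAt W 0 z ∨ W z = q z := fun z hz =>
    (hW z hz).imp id And.right
  have core : ∀ {x y : ℝ}, x ∈ Ioo a b → y ∈ Ioo a b → x ≤ y →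
      W x = W y ∨ ∃ s ∈ Icc x y, ∃ t ∈ Icc x y, W x = q s ∧ W y = q t :=
    fun hx hy hxy => eq_or_exists_eq hxy (fun z hz => hP z (hsub hx hy hz))
      (fun z hz => hq z (hsub hx hy hz)) (fun z hz => hW' z (hsub hx hy hz))
  have hcont : ∀ z ∈ Ioo a b, ContinuousAt W z := by
    intro z hz
    rw [Metric.continuousAt_iff]
    intro ε hε
    obtain ⟨δ, hδ, hqδ⟩ := Metric.continuousAt_iff.1 (hq z hz) (ε / 2) (half_pos hε)
    obtain ⟨δ', hδ', hI⟩ := Metric.isOpen_iff.1 (isOpen_Ioo (a := a) (b := b)) z hz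
    refine ⟨min δ δ', lt_min hδ hδ', fun {y} hy => ?_⟩
    have hyI : y ∈ Ioo a b := hI (hy.trans_le (min_le_right _ _))
    have hyδ : |y - z| < δ := by
      rw [← Real.dist_eq]; exact hy.trans_le (min_le_left _ _)
    have fin : ∀ s t : ℝ, |s - z| < δ → |t - z| < δ → |q s - q t| < ε := by
      intro s t hs ht
      have h1 := hqδ (x := s) (by rwa [Real.dist_eq])
      have h2 := hqδ (x := t) (by rwa [Real.dist_eq])
      rw [Real.dist_eq] at h1 h2
      rw [abs_lt] at *
      constructor <;> linarith
    rw [Real.dist_eq]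
    rcases le_total z y with h | h
    · rw [abs_of_nonneg (by linarith)] at hyδ
      rcases core hz hyI h with h1 | ⟨s, hs, t, ht, h1, h2⟩
      · rw [h1]; simpa using hε
      · rw [h1, h2]
        exact fin t s (by rw [abs_of_nonneg (by linarith [ht.1])]; linarith [ht.2])
          (by rw [abs_of_nonneg (by linarith [hs.1])]; linarith [hs.2])
    · rw [abs_of_nonpos (by linarith)] at hyδ
      rcases core hyI hz h with h1 | ⟨s, hs, t, ht, h1, h2⟩
      · rw [h1]; simpa using hε
      · rw [h1, h2]
        exact fin s t (by rw [abs_of_nonpos (by linarith [hs.2])]; linarith [hs.1])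
          (by rw [abs_of_nonpos (by linarith [ht.2])]; linarith [ht.1])
  have hqC := hqW hcont
  have hle : ∀ x ∈ Ioo a b, ∀ y ∈ Ioo a b, x ≤ y → W x = W y := by
    intro x hx y hy hxy
    obtain ⟨K, hK⟩ := (hqC.mono (hsub hx hy)).exists_lipschitzOnWith one_ne_zero
      (convex_Icc x y) isCompact_Icc
    have hlip : LipschitzOnWith K W (uIcc x y) := by
      rw [uIcc_of_le hxy]
      have hle' : ∀ u ∈ Icc x y, ∀ v ∈ Icc x y, u ≤ v → dist (W u) (W v) ≤ K * dist u v := by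
        intro u hu v hv huv
        rcases core (hsub hx hy hu) (hsub hx hy hv) huv with h1 | ⟨s, hs, t, ht, h1, h2⟩
        · rw [h1, dist_self]; positivity
        · rw [h1, h2]
          refine (hK.dist_le_mul s ⟨hu.1.trans hs.1, hs.2.trans hv.2⟩ t
            ⟨hu.1.trans ht.1, ht.2.trans hv.2⟩).trans ?_
          refine mul_le_mul_of_nonneg_left ?_ K.2
          rw [dist_comm u v]
          exact Real.dist_le_of_mem_Icc hs ht |>.trans (by
            rw [Real.dist_eq, abs_of_nonneg (by linarith)])
      refine LipschitzOnWith.of_dist_le_mul fun u hu v hv => ?_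
      rcases le_total u v with h | h
      · exact hle' u hu v hv h
      · rw [dist_comm, dist_comm u v]; exact hle' v hv u hu h
    have hint := hlip.absolutelyContinuousOnInterval.integral_deriv_eq_sub
    have hzero : ∫ z in x..y, deriv W z = ∫ z in x..y, (0 : ℝ) := by
      refine intervalIntegral.integral_congr fun z hz => ?_
      rw [uIcc_of_le hxy] at hz
      rcases hW z (hsub hx hy hz) with h | h
      · exact h.deriv
      · exact deriv_zero_of_not_differentiableAt h.1
    rw [hzero, intervalIntegral.integral_zero] at hint
    linarith
  intro x hx y hy
  rcases le_total x y with h | h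
  · exact hle x hx y hy h
  · exact (hle y hy x hx h).symm

/-- The equation forces differentiability away from the curve `α f = ξ ^ σ f ^ p`. -/
lemma differentiableAt_of_equation {m p σ α β : ℝ} {f : ℝ → ℝ} {x : ℝ} (hm : m ≠ 0)
    (hpos : ∀ᶠ y in 𝓝 x, 0 < f y) (hc : ContinuousAt f x) (hne : α * f x ≠ x ^ σ * f x ^ p)
    (heq : deriv (deriv (Fm m f)) x - α * f x + β * x * deriv f x + x ^ σ * f x ^ p = 0) :
    DifferentiableAt ℝ f x := by
  have hroot : DifferentiableAt ℝ (Fm m f) x → DifferentiableAt ℝ f x := by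
    intro h
    have h1 : DifferentiableAt ℝ (fun y => Fm m f y ^ m⁻¹) x :=
      h.rpow_const (Or.inl (Real.rpow_pos_of_pos hpos.self_of_nhds m).ne')
    refine h1.congr_of_eventuallyEq ?_
    filter_upwards [hpos] with y hy
    rw [Fm, Real.rpow_rpow_inv hy.le hm]
  by_contra hnd
  have hFnd : ¬ DifferentiableAt ℝ (Fm m f) x := fun h => hnd (hroot h)
  have hD0 : deriv (Fm m f) x = 0 := deriv_zero_of_not_differentiableAt hFnd
  rw [deriv_zero_of_not_differentiableAt hnd] at heq
  have hDD : deriv (deriv (Fm m f)) x ≠ 0 := by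
    intro h
    rw [h] at heq
    exact hne (by linarith)
  have hDdiff : DifferentiableAt ℝ (deriv (Fm m f)) x := by
    by_contra h
    exact hDD (deriv_zero_of_not_differentiableAt h)
  have hev : ∀ᶠ z in 𝓝[≠] x, deriv (Fm m f) z ≠ 0 := hDdiff.hasDerivAt.eventually_ne hDD
  have hFd : ∀ᶠ z in 𝓝[≠] x, DifferentiableAt ℝ (Fm m f) z := by
    filter_upwards [hev] with z hz
    by_contra h
    exact hz (deriv_zero_of_not_differentiableAt h)
  have hFc : ContinuousAt (Fm m f) x := hc.rpow_const (Or.inl hpos.self_of_nhds.ne')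
  have hlim : Tendsto (fun z => deriv (Fm m f) z) (𝓝 x) (𝓝 0) := by
    simpa [hD0] using hDdiff.continuousAt.tendsto
  have hR : HasDerivWithinAt (Fm m f) 0 (Ici x) x := by
    refine hasDerivWithinAt_Ici_of_tendsto_deriv (s := {z | DifferentiableAt ℝ (Fm m f) z})
      (fun z hz => DifferentiableAt.differentiableWithinAt hz) hFc.continuousWithinAt ?_
      (hlim.mono_left nhdsWithin_le_nhds)
    exact nhdsWithin_mono x (fun z (hz : x < z) => ne_of_gt hz) hFd
  have hL : HasDerivWithinAt (Fm m f) 0 (Iic x) x := by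
    refine hasDerivWithinAt_Iic_of_tendsto_deriv (s := {z | DifferentiableAt ℝ (Fm m f) z})
      (fun z hz => DifferentiableAt.differentiableWithinAt hz) hFc.continuousWithinAt ?_
      (hlim.mono_left nhdsWithin_le_nhds)
    exact nhdsWithin_mono x (fun z (hz : z < x) => ne_of_lt hz) hFd
  have hU := hL.union hR
  rw [Iic_union_Ici, hasDerivWithinAt_univ] at hU
  exact hFnd hU.differentiableAt

lemma contDiffOn_one_of_hasDerivAt {g g' : ℝ → ℝ} {s : Set ℝ} (hs : IsOpen s)
    (h : ∀ x ∈ s, HasDerivAt g (g' x) x) (hc : ContinuousOn g' s) : ContDiffOn ℝ 1 g s := by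
  rw [show (1 : WithTop ℕ∞) = 0 + 1 by simp, contDiffOn_succ_iff_deriv_of_isOpen hs]
  refine ⟨fun x hx => (h x hx).differentiableAt.differentiableWithinAt, by simp, ?_⟩
  rw [contDiffOn_zero]
  exact hc.congr fun x hx => (h x hx).deriv

lemma hasDerivAt_Fm {m : ℝ} {f : ℝ → ℝ} {x : ℝ} (hf : DifferentiableAt ℝ f x) (hx : 0 < f x) :
    HasDerivAt (Fm m f) (deriv f x * m * f x ^ (m - 1)) x :=
  hf.hasDerivAt.rpow_const (Or.inl hx.ne')

/-- Away from the curve `α f = ξ ^ σ f ^ p` the pointwise equation is the classical one. -/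
lemma SolvesODE.regular {m p σ α β : ℝ} {f : ℝ → ℝ} {a b : ℝ} (ha : 0 ≤ a) (hm : m ≠ 0)
    (hβ : β ≠ 0) (hc : ContinuousOn f (Ioo a b)) (hpos : ∀ x ∈ Ioo a b, 0 < f x)
    (hne : ∀ x ∈ Ioo a b, α * f x ≠ x ^ σ * f x ^ p) (hode : SolvesODE m p σ α β f (Ioo a b)) :
    ∀ x ∈ Ioo a b, DifferentiableAt ℝ f x ∧
      HasDerivAt (deriv (Fm m f)) (α * f x - β * x * deriv f x - x ^ σ * f x ^ p) x := by
  have hnhds : ∀ x ∈ Ioo a b, Ioo a b ∈ 𝓝 x := fun x hx => isOpen_Ioo.mem_nhds hx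
  have hcAt : ∀ x ∈ Ioo a b, ContinuousAt f x := fun x hx => hc.continuousAt (hnhds x hx)
  have hfd : ∀ x ∈ Ioo a b, DifferentiableAt ℝ f x := fun x hx =>
    differentiableAt_of_equation hm (Filter.mem_of_superset (hnhds x hx) hpos) (hcAt x hx)
      (hne x hx) (hode x hx)
  have hF : ∀ x ∈ Ioo a b, HasDerivAt (Fm m f) (deriv f x * m * f x ^ (m - 1)) x := fun x hx =>
    hasDerivAt_Fm (hfd x hx) (hpos x hx)
  intro x₀ hx₀
  refine ⟨hfd x₀ hx₀, ?_⟩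
  have hx0 : ∀ x ∈ Ioo a b, x ≠ 0 := fun x hx => (ha.trans_lt hx.1).ne'
  set g : ℝ → ℝ := fun t => (α + β) * f t - t ^ σ * f t ^ p with hg
  have hgc : ContinuousOn g (Ioo a b) := by
    refine (continuousOn_const.mul hc).sub (ContinuousOn.mul ?_ ?_)
    · exact fun t ht => (Real.continuousAt_rpow_const t σ
        (Or.inl (hx0 t ht))).continuousWithinAt
    · exact hc.rpow_const fun t ht => Or.inl (hpos t ht).ne'
  have primitive : ∀ {u : ℝ → ℝ}, ContinuousOn u (Ioo a b) → ∀ x ∈ Ioo a b,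
      HasDerivAt (fun y => ∫ t in x₀..y, u t) (u x) x := by
    intro u hu x hx
    have hsub : uIcc x₀ x ⊆ Ioo a b := ordConnected_Ioo.uIcc_subset hx₀ hx
    exact intervalIntegral.integral_hasDerivAt_right (hu.mono hsub).intervalIntegrable
      (hu.stronglyMeasurableAtFilter isOpen_Ioo x hx) (hu.continuousAt (hnhds x hx))
  set G : ℝ → ℝ := fun x => α * f x - β * x * deriv f x - x ^ σ * f x ^ p with hG
  set Φ : ℝ → ℝ := fun x => β * x * f x - ∫ t in x₀..x, g t with hΦ
  have hΦd : ∀ x ∈ Ioo a b, HasDerivAt Φ (-G x) x := by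
    intro x hx
    have h1 := (((hasDerivAt_id x).const_mul β).mul (hfd x hx).hasDerivAt).sub (primitive hgc x hx)
    refine h1.congr_deriv ?_
    simp only [hG, hg, id]
    ring
  have hΦc : ContinuousOn Φ (Ioo a b) := fun x hx => (hΦd x hx).continuousAt.continuousWithinAt
  set W : ℝ → ℝ := fun x => deriv (Fm m f) x + Φ x with hWdef
  set c : ℝ → ℝ := fun x => (α * f x - x ^ σ * f x ^ p) / (β * x) * m * f x ^ (m - 1) with hcdef
  have hcC : ContDiffOn ℝ 1 f (Ioo a b) → ContDiffOn ℝ 1 c (Ioo a b) := by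
    intro hfC
    have hfp : ∀ r : ℝ, ContDiffOn ℝ 1 (fun x => f x ^ r) (Ioo a b) := fun r =>
      hfC.rpow_const_of_ne fun x hx => (hpos x hx).ne'
    have hxp : ContDiffOn ℝ 1 (fun x : ℝ => x ^ σ) (Ioo a b) :=
      contDiffOn_id.rpow_const_of_ne hx0
    exact ((((contDiffOn_const.mul hfC).sub (hxp.mul (hfp p))).div
      (contDiffOn_const.mul contDiffOn_id) fun x hx => mul_ne_zero hβ (hx0 x hx)).mul
      contDiffOn_const).mul (hfp (m - 1))
  have hcc : ContinuousOn c (Ioo a b) := by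
    have hfp : ∀ r : ℝ, ContinuousOn (fun x => f x ^ r) (Ioo a b) := fun r =>
      hc.rpow_const fun x hx => Or.inl (hpos x hx).ne'
    have hxp : ContinuousOn (fun x : ℝ => x ^ σ) (Ioo a b) :=
      continuousOn_id.rpow_const fun x hx => Or.inl (hx0 x hx)
    exact ((((continuousOn_const.mul hc).sub (hxp.mul (hfp p))).div
      (continuousOn_const.mul continuousOn_id) fun x hx => mul_ne_zero hβ (hx0 x hx)).mul
      continuousOn_const).mul (hfp (m - 1))
  have hconst := derivative_constant_of_stationary_or_eq (a := a) (b := b)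
    (P := fun x => Fm m f x + ∫ t in x₀..x, Φ t) (W := W) (q := fun x => c x + Φ x)
    (fun x hx => (hF x hx).differentiableAt.hasDerivAt.add (primitive hΦc x hx))
    (fun x hx => (hcc.continuousAt (hnhds x hx)).add (hΦd x hx).continuousAt)
    (fun x hx => by
      have hx' := hode x hx
      by_cases hD : DifferentiableAt ℝ (deriv (Fm m f)) x
      · left
        refine (hD.hasDerivAt.add (hΦd x hx)).congr_deriv ?_
        simp only [hG]
        linarith
      · right
        refine ⟨fun hWd => hD ?_, ?_⟩
        · have : DifferentiableAt ℝ (fun y => W y - Φ y) x := hWd.sub (hΦd x hx).differentiableAt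
          simpa [hWdef] using this
        · rw [deriv_zero_of_not_differentiableAt hD] at hx'
          simp only [hWdef, hcdef, add_left_inj]
          rw [(hF x hx).deriv]
          have hne0 := mul_ne_zero hβ (hx0 x hx)
          rw [show deriv f x = (α * f x - x ^ σ * f x ^ p) / (β * x) by
            rw [eq_div_iff hne0]; linarith])
    (fun hWc => by
      have hDc : ContinuousOn (deriv (Fm m f)) (Ioo a b) := by
        have : ContinuousOn (fun y => W y - Φ y) (Ioo a b) :=
          ContinuousOn.sub (fun x hx => (hWc x hx).continuousWithinAt) hΦc
        simpa [hWdef] using this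
      have hf'c : ContinuousOn (deriv f) (Ioo a b) := by
        have : ContinuousOn (fun x => deriv (Fm m f) x / (m * f x ^ (m - 1))) (Ioo a b) :=
          hDc.div (continuousOn_const.mul (hc.rpow_const fun x hx => Or.inl (hpos x hx).ne'))
            fun x hx => mul_ne_zero hm (Real.rpow_pos_of_pos (hpos x hx) _).ne'
        refine this.congr fun x hx => ?_
        simp only [(hF x hx).deriv]
        have := (Real.rpow_pos_of_pos (hpos x hx) (m - 1)).ne'
        field_simp
      have hfC : ContDiffOn ℝ 1 f (Ioo a b) :=
        contDiffOn_one_of_hasDerivAt isOpen_Ioo (fun x hx => (hfd x hx).hasDerivAt) hf'c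
      exact (hcC hfC).add ((contDiffOn_const.mul contDiffOn_id |>.mul hfC).sub
        (contDiffOn_one_of_hasDerivAt isOpen_Ioo (primitive hgc) hgc)))
  have hev : deriv (Fm m f) =ᶠ[𝓝 x₀] fun y => W x₀ - Φ y := by
    filter_upwards [hnhds x₀ hx₀] with y hy
    rw [hconst x₀ hx₀ y hy]
    simp [hWdef]
  exact (((hΦd x₀ hx₀).const_sub (W x₀)).congr_of_eventuallyEq hev).congr_deriv (by simp [hG])

/-- If `F' + φ` is nonincreasing up to `r`, `φ` vanishes at `r` and so does the left derivative of
`F`, then `F' + φ` is nonnegative. -/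
lemma nonneg_of_antitoneOn_add {F D φ : ℝ → ℝ} {l r : ℝ}
    (hF : ∀ x ∈ Ioo l r, HasDerivAt F (D x) x) (hr : HasDerivWithinAt F 0 (Iic r) r)
    (hanti : AntitoneOn (fun x => D x + φ x) (Ioo l r)) (hφ : Tendsto φ (𝓝[<] r) (𝓝 0)) :
    ∀ x ∈ Ioo l r, 0 ≤ D x + φ x := by
  intro x hx
  by_contra! hneg
  set ε := -(D x + φ x) / 2 with hε
  have hεpos : 0 < ε := by linarith
  have hφε : ∀ᶠ z in 𝓝[<] r, -ε < φ z := hφ.eventually_const_lt (by linarith)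
  obtain ⟨l', hl', hl'φ⟩ := (mem_nhdsLT_iff_exists_Ioo_subset' hx.2).1 hφε
  have hl'r : l' < r := hl'
  set y := max x l' with hy
  have hyr : y < r := max_lt hx.2 hl'r
  have hD : ∀ z ∈ Ioo y r, D z ≤ -ε := by
    intro z hz
    have hxz : x < z := (le_max_left _ _).trans_lt hz.1
    have h1 := hanti hx ⟨hx.1.trans hxz, hz.2⟩ hxz.le
    have h2 : -ε < φ z := hl'φ ⟨(le_max_right _ _).trans_lt hz.1, hz.2⟩
    simp only at h1
    linarith
  have hlx : l < y := hx.1.trans_le (le_max_left _ _)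
  have hslope : ∀ z ∈ Ioo y r, slope F r z ≤ -ε := by
    intro z hz
    have hcont : ContinuousOn F (Icc z r) := by
      intro t ht
      rcases ht.2.eq_or_lt with h | h
      · rw [h]
        exact hr.continuousWithinAt.mono fun s hs => hs.2
      · exact (hF t ⟨hlx.trans (hz.1.trans_le ht.1), h⟩).continuousAt.continuousWithinAt
    obtain ⟨t, ht, hts⟩ := exists_hasDerivAt_eq_slope F D hz.2 hcont fun t ht =>
      hF t ⟨hlx.trans (hz.1.trans ht.1), ht.2⟩
    have : slope F r z = D t := by
      rw [slope_comm, slope_def_field, hts]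
    rw [this]
    exact hD t ⟨hz.1.trans ht.1, ht.2⟩
  have hlim : Tendsto (slope F r) (𝓝[<] r) (𝓝 0) := by
    have := hasDerivWithinAt_iff_tendsto_slope.1 hr
    rwa [Iic_sdiff_right] at this
  have := le_of_tendsto hlim (by
    filter_upwards [Ioo_mem_nhdsLT hyr] with z hz using hslope z hz)
  linarith

/-- A positive function with `u' ≤ -k u ^ θ`, `θ < 1`, would become extinct after a time
`u ^ (1 - θ) / ((1 - θ) k)`. -/
lemma extinction_time_le {u u' : ℝ → ℝ} {x y k θ : ℝ} (hxy : x ≤ y) (hθ : θ < 1)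
    (hpos : ∀ z ∈ Icc x y, 0 < u z) (hu : ∀ z ∈ Icc x y, HasDerivAt u (u' z) z)
    (hle : ∀ z ∈ Icc x y, u' z ≤ -(k * u z ^ θ)) :
    (1 - θ) * k * (y - x) ≤ u x ^ (1 - θ) := by
  have hv : ∀ z ∈ Icc x y, HasDerivAt (fun z => u z ^ (1 - θ) + (1 - θ) * k * z)
      (u' z * (1 - θ) * u z ^ (1 - θ - 1) + (1 - θ) * k * 1) z := fun z hz =>
    ((hu z hz).rpow_const (Or.inl (hpos z hz).ne')).add ((hasDerivAt_id z).const_mul _)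
  have hanti : AntitoneOn (fun z => u z ^ (1 - θ) + (1 - θ) * k * z) (Icc x y) := by
    refine antitoneOn_of_deriv_nonpos (convex_Icc x y)
      (fun z hz => (hv z hz).continuousAt.continuousWithinAt)
      (fun z hz => (hv z (interior_subset hz)).differentiableAt.differentiableWithinAt)
      fun z hz => ?_
    have hz' := interior_subset hz
    rw [(hv z hz').deriv]
    have hp := Real.rpow_pos_of_pos (hpos z hz') (1 - θ - 1)
    have hone : u z ^ θ * u z ^ (1 - θ - 1) = 1 := by
      rw [← Real.rpow_add (hpos z hz')]; norm_num
    have h1 : u' z * u z ^ (1 - θ - 1) ≤ -k := by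
      calc u' z * u z ^ (1 - θ - 1) ≤ -(k * u z ^ θ) * u z ^ (1 - θ - 1) :=
            mul_le_mul_of_nonneg_right (hle z hz') hp.le
        _ = -k * (u z ^ θ * u z ^ (1 - θ - 1)) := by ring
        _ = -k := by rw [hone, mul_one]
    nlinarith [mul_le_mul_of_nonneg_left h1 (sub_pos.2 hθ).le]
  have h := hanti ⟨le_rfl, hxy⟩ ⟨hxy, le_rfl⟩ hxy
  have h2 := (Real.rpow_pos_of_pos (hpos y ⟨hxy, le_rfl⟩) (1 - θ)).le
  simp only at h
  linarith

/-- Classical positive solutions on `(a, b)` for which the reaction dominates the zeroth order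
terms with a margin `κ f ^ p`. -/
structure IsReactionDominated (m p σ α β κ : ℝ) (f : ℝ → ℝ) (a b : ℝ) : Prop where
  left_nonneg : 0 ≤ a
  pos : ∀ x ∈ Ioo a b, 0 < f x
  diff : ∀ x ∈ Ioo a b, DifferentiableAt ℝ f x
  flux : ∀ x ∈ Ioo a b,
    HasDerivAt (deriv (Fm m f)) (α * f x - β * x * deriv f x - x ^ σ * f x ^ p) x
  reaction : ∀ x ∈ Ioo a b, (α + β) * f x + κ * f x ^ p ≤ x ^ σ * f x ^ p

namespace IsReactionDominated

variable {m p σ α β κ : ℝ} {f : ℝ → ℝ} {a b : ℝ}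

lemma deriv_Fm (h : IsReactionDominated m p σ α β κ f a b) {x : ℝ} (hx : x ∈ Ioo a b) :
    deriv (Fm m f) x = deriv f x * (m * f x ^ (m - 1)) := by
  rw [(hasDerivAt_Fm (h.diff x hx) (h.pos x hx)).deriv, mul_assoc]

lemma hasDerivAt_pow (h : IsReactionDominated m p σ α β κ f a b) {x : ℝ} (hx : x ∈ Ioo a b) :
    HasDerivAt (Fm m f) (deriv (Fm m f) x) x :=
  (hasDerivAt_Fm (h.diff x hx) (h.pos x hx)).differentiableAt.hasDerivAt

lemma hasDerivAt_flux_add (h : IsReactionDominated m p σ α β κ f a b) {x : ℝ}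
    (hx : x ∈ Ioo a b) :
    HasDerivAt (fun x => deriv (Fm m f) x + β * x * f x)
      ((α + β) * f x - x ^ σ * f x ^ p) x := by
  refine ((h.flux x hx).add
    (((hasDerivAt_id x).const_mul β).mul (h.diff x hx).hasDerivAt)).congr_deriv ?_
  simp only [id]
  ring

lemma factor_pos (h : IsReactionDominated m p σ α β κ f a b) (hm : 0 < m) {x : ℝ}
    (hx : x ∈ Ioo a b) : 0 < m * f x ^ (m - 1) :=
  mul_pos hm (Real.rpow_pos_of_pos (h.pos x hx) _)

lemma flux_deriv_le (h : IsReactionDominated m p σ α β κ f a b) (hm : 0 < m) (hβ : 0 < β)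
    {x : ℝ} (hx : x ∈ Ioo a b) (hD : 0 ≤ deriv (Fm m f) x) :
    α * f x - β * x * deriv f x - x ^ σ * f x ^ p ≤ -(κ * f x ^ p) - β * f x := by
  have hf' : 0 ≤ deriv f x := by
    rw [h.deriv_Fm hx] at hD
    exact nonneg_of_mul_nonneg_left hD (h.factor_pos hm hx)
  have hx0 : 0 < x := h.left_nonneg.trans_lt hx.1
  have := h.reaction x hx
  have h1 : 0 ≤ β * x * deriv f x := by positivity
  linarith

lemma flux_deriv_neg (h : IsReactionDominated m p σ α β κ f a b) (hm : 0 < m) (hβ : 0 < β)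
    (hκ : 0 ≤ κ) {x : ℝ} (hx : x ∈ Ioo a b) (hD : 0 ≤ deriv (Fm m f) x) :
    α * f x - β * x * deriv f x - x ^ σ * f x ^ p < 0 := by
  have h1 := h.flux_deriv_le hm hβ hx hD
  have h2 := h.pos x hx
  have h3 : 0 ≤ κ * f x ^ p := by positivity
  have h4 : 0 < β * f x := by positivity
  linarith

/-- Nonnegativity of the flux propagates backward. -/
lemma flux_nonneg_of_le (h : IsReactionDominated m p σ α β κ f a b) (hm : 0 < m) (hβ : 0 < β)
    (hκ : 0 ≤ κ) {x₀ : ℝ} (hx₀ : x₀ ∈ Ioo a b) (hD : 0 ≤ deriv (Fm m f) x₀) :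
    ∀ x ∈ Ioc a x₀, 0 ≤ deriv (Fm m f) x := by
  intro x hx
  have hmem : ∀ t ∈ Icc (-x₀) (-x), -t ∈ Ioo a b := fun t ht =>
    ⟨by linarith [ht.2, hx.1], by linarith [ht.1, hx₀.2]⟩
  have hd : ∀ t ∈ Icc (-x₀) (-x), HasDerivAt (fun t => -deriv (Fm m f) (-t))
      (α * f (-t) - β * (-t) * deriv f (-t) - (-t) ^ σ * f (-t) ^ p) t := by
    intro t ht
    refine ((h.flux (-t) (hmem t ht)).scomp t (hasDerivAt_neg t)).neg.congr_deriv ?_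
    simp
  have := image_le_of_deriv_right_lt_deriv_boundary (B := fun _ => 0) (B' := fun _ => 0)
    (fun t ht => (hd t ht).continuousAt.continuousWithinAt)
    (fun t ht => (hd t (Ico_subset_Icc_self ht)).hasDerivWithinAt)
    (by simpa using hD) (fun t => hasDerivAt_const t 0)
    (fun t ht h0 => h.flux_deriv_neg hm hβ hκ (hmem t (Ico_subset_Icc_self ht))
      (by linarith)) (x := -x) ⟨neg_le_neg hx.2, le_rfl⟩
  simpa using this

lemma strictAntiOn_flux (h : IsReactionDominated m p σ α β κ f a b) (hm : 0 < m) (hβ : 0 < β)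
    (hκ : 0 ≤ κ) {x₀ : ℝ} (hx₀ : x₀ ∈ Ioo a b) (hD : 0 ≤ deriv (Fm m f) x₀) :
    StrictAntiOn (deriv (Fm m f)) (Ioc a x₀) := by
  have hmem : ∀ t ∈ Ioc a x₀, t ∈ Ioo a b := fun t ht => ⟨ht.1, ht.2.trans_lt hx₀.2⟩
  refine strictAntiOn_of_deriv_neg (convex_Ioc a x₀)
    (fun t ht => (h.flux t (hmem t ht)).continuousAt.continuousWithinAt) fun t ht => ?_
  have ht' := interior_subset ht
  rw [(h.flux t (hmem t ht')).deriv]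
  exact h.flux_deriv_neg hm hβ hκ (hmem t ht') (h.flux_nonneg_of_le hm hβ hκ hx₀ hD t ht')

lemma flux_pos_of_lt (h : IsReactionDominated m p σ α β κ f a b) (hm : 0 < m) (hβ : 0 < β)
    (hκ : 0 ≤ κ) {x₀ : ℝ} (hx₀ : x₀ ∈ Ioo a b) (hD : 0 ≤ deriv (Fm m f) x₀) :
    ∀ x ∈ Ioo a x₀, 0 < deriv (Fm m f) x := fun _ hx =>
  hD.trans_lt (h.strictAntiOn_flux hm hβ hκ hx₀ hD ⟨hx.1, hx.2.le⟩ ⟨hx₀.1, le_rfl⟩ hx.2)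

lemma strictAntiOn_flux_add (h : IsReactionDominated m p σ α β κ f a b) (hκ : 0 < κ) :
    StrictAntiOn (fun x => deriv (Fm m f) x + β * x * f x) (Ioo a b) := by
  refine strictAntiOn_of_deriv_neg (convex_Ioo a b)
    (fun x hx => (h.hasDerivAt_flux_add hx).continuousAt.continuousWithinAt) fun x hx => ?_
  have hx' := interior_subset hx
  rw [(h.hasDerivAt_flux_add hx').deriv]
  have h1 := h.reaction x hx'
  have h2 : 0 < κ * f x ^ p := mul_pos hκ (Real.rpow_pos_of_pos (h.pos x hx') p)
  linarith

/-- At an interface, the flux is controlled by the drift. -/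
lemma flux_add_pos (h : IsReactionDominated m p σ α β κ f a b) (hκ : 0 < κ)
    (hF : HasDerivWithinAt (Fm m f) 0 (Iic b) b) (hf : Tendsto f (𝓝[<] b) (𝓝 0)) :
    ∀ x ∈ Ioo a b, 0 < deriv (Fm m f) x + β * x * f x := by
  have hφ : Tendsto (fun x => β * x * f x) (𝓝[<] b) (𝓝 0) := by
    have h1 : Tendsto (fun x : ℝ => β * x) (𝓝[<] b) (𝓝 (β * b)) :=
      ((continuous_const.mul continuous_id).tendsto b).mono_left nhdsWithin_le_nhds
    simpa using h1.mul hf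
  have hnn := nonneg_of_antitoneOn_add (fun _ hx => h.hasDerivAt_pow hx) hF
    (h.strictAntiOn_flux_add hκ).antitoneOn hφ
  intro x hx
  obtain ⟨y, hxy, hyb⟩ := exists_between hx.2
  have hy : y ∈ Ioo a b := ⟨hx.1.trans hxy, hyb⟩
  exact (hnn y hy).trans_lt (h.strictAntiOn_flux_add hκ hx hy hxy)

/-- Before its maximum (seen from the interface), the profile obeys a power-type bound. -/
lemma pow_le_of_flux_nonpos (h : IsReactionDominated m p σ α β κ f a b) (hm : 0 < m)
    (hmp : 1 < m + p) (hβ : 0 < β) (hκ : 0 < κ)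
    (hF : HasDerivWithinAt (Fm m f) 0 (Iic b) b) (hf : Tendsto f (𝓝[<] b) (𝓝 0))
    (hD : ∀ x ∈ Ioo a b, deriv (Fm m f) x ≤ 0) :
    ∀ x ∈ Ioo a b, κ * m / ((m + p - 1) * (β * b)) * f x ^ (m + p - 1) ≤ β * b * f x := by
  intro x hx
  have hb : 0 < b := h.left_nonneg.trans_lt (hx.1.trans hx.2)
  set lam := κ * m / ((m + p - 1) * (β * b)) with hlam
  have hs : 0 < m + p - 1 := by linarith
  have hlampos : 0 < lam := by positivity
  have hE : ∀ z ∈ Ioo a b, HasDerivAt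
      (fun z => deriv (Fm m f) z + (β * b * f z - lam * f z ^ (m + p - 1)))
      (α * f z - β * z * deriv f z - z ^ σ * f z ^ p +
        (β * b * deriv f z - lam * (deriv f z * (m + p - 1) * f z ^ (m + p - 1 - 1)))) z := by
    intro z hz
    have hfz := (h.diff z hz).hasDerivAt
    exact (h.flux z hz).add ((hfz.const_mul _).sub
      ((hfz.rpow_const (Or.inl (h.pos z hz).ne')).const_mul _))
  have hanti : AntitoneOn
      (fun z => deriv (Fm m f) z + (β * b * f z - lam * f z ^ (m + p - 1))) (Ioo a b) := by
    refine antitoneOn_of_deriv_nonpos (convex_Ioo a b)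
      (fun z hz => (hE z hz).continuousAt.continuousWithinAt)
      (fun z hz => (hE z (interior_subset hz)).differentiableAt.differentiableWithinAt)
      fun z hz => ?_
    replace hz := interior_subset hz
    rw [(hE z hz).deriv]
    have hfz := h.pos z hz
    have hz0 : 0 < z := h.left_nonneg.trans_lt hz.1
    have hDz := hD z hz
    have hV := h.flux_add_pos hκ hF hf z hz
    rw [h.deriv_Fm hz] at hDz hV
    have hf' : deriv f z ≤ 0 := by
      by_contra! hc
      exact absurd (mul_pos hc (h.factor_pos hm hz)) (not_lt.2 hDz)
    have hsplit : f z ^ (m + p - 1 - 1) = f z ^ (p - 1) * f z ^ (m - 1) := by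
      rw [← Real.rpow_add hfz]; ring_nf
    have hp1 : f z ^ (p - 1) * f z = f z ^ p := by
      rw [← Real.rpow_add_one hfz.ne']; ring_nf
    have hq : 0 < f z ^ (p - 1) := Real.rpow_pos_of_pos hfz _
    have hbound : -(deriv f z * (m * f z ^ (m - 1))) ≤ β * b * f z := by
      have : β * z * f z ≤ β * b * f z := by
        have := hz.2.le
        gcongr
      linarith
    have h1 : lam * (m + p - 1) / m * f z ^ (p - 1) * -(deriv f z * (m * f z ^ (m - 1))) ≤
        κ * f z ^ p := by
      calc _ ≤ lam * (m + p - 1) / m * f z ^ (p - 1) * (β * b * f z) := by gcongr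
        _ = lam * (m + p - 1) / m * (β * b) * (f z ^ (p - 1) * f z) := by ring
        _ = κ * f z ^ p := by
          rw [hp1, hlam]
          field_simp
    have h2 : lam * (deriv f z * (m + p - 1) * f z ^ (m + p - 1 - 1)) =
        -(lam * (m + p - 1) / m * f z ^ (p - 1) * -(deriv f z * (m * f z ^ (m - 1)))) := by
      rw [hsplit]
      field_simp
    have h3 := h.reaction z hz
    have h4 : β * (b - z) * deriv f z ≤ 0 :=
      mul_nonpos_of_nonneg_of_nonpos (mul_nonneg hβ.le (sub_nonneg.2 hz.2.le)) hf'
    have h5 : 0 < β * f z := mul_pos hβ hfz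
    rw [h2]
    linarith
  have hφ : Tendsto (fun z => β * b * f z - lam * f z ^ (m + p - 1)) (𝓝[<] b) (𝓝 0) := by
    have h1 : Tendsto (fun z => f z ^ (m + p - 1)) (𝓝[<] b) (𝓝 (0 ^ (m + p - 1))) :=
      hf.rpow_const (Or.inr hs.le)
    rw [Real.zero_rpow hs.ne'] at h1
    simpa using (hf.const_mul (β * b)).sub (h1.const_mul lam)
  have := nonneg_of_antitoneOn_add (fun _ hz => h.hasDerivAt_pow hz) hF hanti hφ x hx
  linarith [hD x hx]

lemma exists_flux_nonneg (h : IsReactionDominated m p σ α β κ f a b) (hp0 : 0 ≤ p) (hp1 : p < 1)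
    (hβ : 0 < β) (hκ : 0 < κ) {M s t : ℝ} (hM : ∀ x ∈ Ioo a b, f x < M)
    (hF : HasDerivWithinAt (Fm m f) 0 (Iic b) b) (hf : Tendsto f (𝓝[<] b) (𝓝 0))
    (has : a < s) (hst : s ≤ t) (htb : t < b)
    (hsmall : β * b * M ^ (1 - p) < (1 - p) * κ * (t - s)) :
    ∃ x ∈ Icc s t, 0 ≤ deriv (Fm m f) x := by
  by_contra! hneg
  have hmem : ∀ x ∈ Icc s t, x ∈ Ioo a b := fun x hx => ⟨has.trans_le hx.1, hx.2.trans_lt htb⟩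
  have hs := hmem s ⟨le_rfl, hst⟩
  have hb : 0 < b := h.left_nonneg.trans_lt (hs.1.trans hs.2)
  have hB : 0 < β * b := mul_pos hβ hb
  have hVpos := h.flux_add_pos hκ hF hf
  have hVle : ∀ x ∈ Icc s t, deriv (Fm m f) x + β * x * f x ≤ β * b * f x := by
    intro x hx
    have h1 := h.pos x (hmem x hx)
    have h2 : β * x * f x ≤ β * b * f x := by
      have := (hmem x hx).2.le
      gcongr
    linarith [hneg x hx]
  have key := extinction_time_le (k := κ / (β * b) ^ p) hst hp1
    (fun x hx => hVpos x (hmem x hx)) (fun x hx => h.hasDerivAt_flux_add (hmem x hx))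
    (fun x hx => by
      have h1 := h.reaction x (hmem x hx)
      have h2 := Real.rpow_le_rpow (hVpos x (hmem x hx)).le (hVle x hx) hp0
      rw [Real.mul_rpow hB.le (h.pos x (hmem x hx)).le] at h2
      have hBp := Real.rpow_pos_of_pos hB p
      have h3 : κ / (β * b) ^ p * (deriv (Fm m f) x + β * x * f x) ^ p ≤ κ * f x ^ p := by
        calc _ ≤ κ / (β * b) ^ p * ((β * b) ^ p * f x ^ p) := by gcongr
          _ = κ * f x ^ p := by field_simp
      linarith)
  have hMs := hM s hs
  have hMpos : 0 < M := (h.pos s hs).trans hMs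
  have h1 : (deriv (Fm m f) s + β * s * f s) ^ (1 - p) ≤ (β * b) ^ (1 - p) * M ^ (1 - p) := by
    rw [← Real.mul_rpow hB.le hMpos.le]
    refine Real.rpow_le_rpow (hVpos s hs).le ((hVle s ⟨le_rfl, hst⟩).trans ?_) (by linarith)
    gcongr
  have hBp := Real.rpow_pos_of_pos hB p
  have hsplit : (β * b) ^ (1 - p) * (β * b) ^ p = β * b := by
    rw [← Real.rpow_add hB]; norm_num
  have h2 : (1 - p) * κ * (t - s) ≤ β * b * M ^ (1 - p) := by
    calc (1 - p) * κ * (t - s) = (1 - p) * (κ / (β * b) ^ p) * (t - s) * (β * b) ^ p := by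
          field_simp
      _ ≤ (β * b) ^ (1 - p) * M ^ (1 - p) * (β * b) ^ p := by
          have := key.trans h1
          gcongr
      _ = β * b * M ^ (1 - p) := by rw [mul_right_comm, hsplit]
  linarith

/-- Backward from a point with nonnegative flux, positivity persists only for a short time. -/
lemma backward_time_le (h : IsReactionDominated m p σ α β κ f a b) (hm : 0 < m) (hp0 : 0 ≤ p)
    (hpm : p < m) (hβ : 0 < β) (hκ : 0 < κ) {M x₀ x y : ℝ} (hM : ∀ x ∈ Ioo a b, f x < M)
    (hc : ContinuousOn f (Icc a x₀)) (hfa : 0 ≤ f a) (hx₀ : x₀ ∈ Ioo a b)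
    (hD : 0 ≤ deriv (Fm m f) x₀) (hax : a < x) (hxy : x ≤ y) (hyx : y < x₀) :
    (1 - p / m) * κ * (x - a) * (y - x) ≤ M ^ (m - p) := by
  have hmem : ∀ z ∈ Ioo a x₀, z ∈ Ioo a b := fun z hz => ⟨hz.1, hz.2.trans hx₀.2⟩
  have hI : ∀ z ∈ Icc x y, z ∈ Ioo a x₀ := fun z hz => ⟨hax.trans_le hz.1, hz.2.trans_lt hyx⟩
  have hDpos := h.flux_pos_of_lt hm hβ hκ.le hx₀ hD
  have hconc : ∀ z ∈ Ioo a x₀, deriv (Fm m f) z * (z - a) ≤ Fm m f z := by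
    intro z hz
    have hcF : ContinuousOn (Fm m f) (Icc a z) :=
      (hc.mono (Icc_subset_Icc_right hz.2.le)).rpow_const fun _ _ => Or.inr hm.le
    obtain ⟨t, ht, hts⟩ := exists_hasDerivAt_eq_slope (Fm m f) (deriv (Fm m f)) hz.1 hcF
      fun t ht => h.hasDerivAt_pow (hmem t ⟨ht.1, ht.2.trans hz.2⟩)
    have hDt : deriv (Fm m f) z ≤ deriv (Fm m f) t :=
      (h.strictAntiOn_flux hm hβ hκ.le hx₀ hD ⟨ht.1, (ht.2.trans hz.2).le⟩
        ⟨hz.1, hz.2.le⟩ ht.2).le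
    have hza : 0 < z - a := sub_pos.2 hz.1
    rw [hts, le_div_iff₀ hza] at hDt
    have : 0 ≤ Fm m f a := Real.rpow_nonneg hfa m
    linarith
  have hxa : 0 < x - a := sub_pos.2 hax
  have hθ : p / m < 1 := (div_lt_one hm).2 hpm
  have key := extinction_time_le (k := κ * (x - a) ^ (p / m)) hxy hθ
    (fun z hz => hDpos z (hI z hz)) (fun z hz => h.flux z (hmem z (hI z hz)))
    (fun z hz => by
      have hz' := hI z hz
      have hfz := h.pos z (hmem z hz')
      have h1 := h.flux_deriv_le hm hβ (hmem z hz') (hDpos z hz').le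
      have h2 : (x - a) * deriv (Fm m f) z ≤ Fm m f z := by
        refine le_trans ?_ (hconc z hz')
        rw [mul_comm]
        have := (hDpos z hz').le
        have := hz.1
        gcongr
      have h3 := Real.rpow_le_rpow (mul_nonneg hxa.le (hDpos z hz').le) h2
        (div_nonneg hp0 hm.le)
      rw [Real.mul_rpow hxa.le (hDpos z hz').le, Fm, ← Real.rpow_mul hfz.le,
        mul_div_cancel₀ p hm.ne'] at h3
      have h4 := mul_le_mul_of_nonneg_left h3 hκ.le
      have h5 := mul_pos hβ hfz
      linarith)
  have hx : x ∈ Ioo a x₀ := hI x ⟨le_rfl, hxy⟩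
  have hfx := h.pos x (hmem x hx)
  have hMx := hM x (hmem x hx)
  have h1 : ((x - a) * deriv (Fm m f) x) ^ (1 - p / m) ≤ M ^ (m - p) := by
    have h2 : (x - a) * deriv (Fm m f) x ≤ M ^ m := by
      rw [mul_comm]
      exact (hconc x hx).trans (Real.rpow_le_rpow hfx.le hMx.le hm.le)
    have h3 := Real.rpow_le_rpow (mul_nonneg hxa.le (hDpos x hx).le) h2
      (sub_nonneg.2 hθ.le)
    rwa [← Real.rpow_mul (hfx.trans hMx).le, mul_sub, mul_one, mul_div_cancel₀ p hm.ne'] at h3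
  rw [Real.mul_rpow hxa.le (hDpos x hx).le] at h1
  have hsplit : (x - a) ^ (1 - p / m) * (x - a) ^ (p / m) = x - a := by
    rw [← Real.rpow_add hxa]; norm_num
  have hq := Real.rpow_pos_of_pos hxa (1 - p / m)
  calc (1 - p / m) * κ * (x - a) * (y - x)
      = (x - a) ^ (1 - p / m) * ((1 - p / m) * (κ * (x - a) ^ (p / m)) * (y - x)) := by
        linear_combination -((1 - p / m) * κ * (y - x)) * hsplit
    _ ≤ (x - a) ^ (1 - p / m) * deriv (Fm m f) x ^ (1 - p / m) := by gcongr
    _ ≤ M ^ (m - p) := h1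

/-- At a zero reached backward, the flux has a positive one-sided limit. -/
lemma exists_pos_hasDerivWithinAt (h : IsReactionDominated m p σ α β κ f a b) (hm : 0 < m)
    (hp0 : 0 ≤ p) (hσ : 0 ≤ σ) (hα : 0 ≤ α) (hβ : 0 < β) (hκ : 0 < κ) (hab : a < b)
    (hc : ContinuousOn f (Ico a b)) (hfa : f a = 0) :
    ∃ d > (0 : ℝ), HasDerivWithinAt (Fm m f) d (Ici a) a := by
  have hcF : ContinuousOn (Fm m f) (Ico a b) := hc.rpow_const fun _ _ => Or.inr hm.le
  obtain ⟨c, hac, hcb⟩ := exists_between hab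
  obtain ⟨x₀, hx₀, hslope⟩ := exists_hasDerivAt_eq_slope (Fm m f) (deriv (Fm m f)) hac
    (hcF.mono (Icc_subset_Ico_right hcb))
    fun t ht => h.hasDerivAt_pow ⟨ht.1, ht.2.trans hcb⟩
  have hx₀' : x₀ ∈ Ioo a b := ⟨hx₀.1, hx₀.2.trans hcb⟩
  have hD₀ : 0 < deriv (Fm m f) x₀ := by
    have h1 : 0 < Fm m f c := Real.rpow_pos_of_pos (h.pos c ⟨hac, hcb⟩) m
    have h2 : Fm m f a = 0 := by rw [Fm, hfa, Real.zero_rpow hm.ne']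
    rw [hslope, h2, sub_zero]
    exact div_pos h1 (sub_pos.2 hac)
  have hsub : Icc a x₀ ⊆ Ico a b := Icc_subset_Ico_right hx₀'.2
  have hmem : ∀ x ∈ Ioo a x₀, x ∈ Ioo a b := fun x hx => ⟨hx.1, hx.2.trans hx₀'.2⟩
  have hcr : ContinuousOn (fun x => x ^ σ * f x ^ p) (Icc a x₀) :=
    (continuousOn_id.rpow_const fun _ _ => Or.inr hσ).mul
      ((hc.mono hsub).rpow_const fun _ _ => Or.inr hp0)
  obtain ⟨C, hC⟩ := isCompact_Icc.exists_bound_of_continuousOn hcr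
  have hanti : AntitoneOn (deriv (Fm m f)) (Ioo a x₀) :=
    (h.strictAntiOn_flux hm hβ hκ.le hx₀' hD₀.le).antitoneOn.mono Ioo_subset_Ioc_self
  have hmono : MonotoneOn (fun x => deriv (Fm m f) x + β * x * f x + C * x) (Ioc a x₀) := by
    have hd : ∀ x ∈ Ioc a x₀, HasDerivAt (fun x => deriv (Fm m f) x + β * x * f x + C * x)
        ((α + β) * f x - x ^ σ * f x ^ p + C * 1) x := fun x hx =>
      (h.hasDerivAt_flux_add ⟨hx.1, hx.2.trans_lt hx₀'.2⟩).add ((hasDerivAt_id x).const_mul C)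
    refine monotoneOn_of_deriv_nonneg (convex_Ioc a x₀)
      (fun x hx => (hd x hx).continuousAt.continuousWithinAt)
      (fun x hx => (hd x (interior_subset hx)).differentiableAt.differentiableWithinAt)
      fun x hx => ?_
    replace hx := interior_subset hx
    rw [(hd x hx).deriv]
    have h1 := (le_abs_self _).trans (hC x ⟨hx.1.le, hx.2⟩)
    have h2 := h.pos x ⟨hx.1, hx.2.trans_lt hx₀'.2⟩
    have h3 : 0 ≤ (α + β) * f x := by positivity
    linarith
  have hbdd : BddAbove (deriv (Fm m f) '' Ioo a x₀) := by
    refine ⟨deriv (Fm m f) x₀ + β * x₀ * f x₀ + C * x₀ + |C| * x₀, ?_⟩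
    rintro _ ⟨x, hx, rfl⟩
    have h1 := hmono ⟨hx.1, hx.2.le⟩ ⟨hx₀.1, le_rfl⟩ hx.2.le
    simp only at h1
    have hx0 : 0 < x := h.left_nonneg.trans_lt hx.1
    have h2 : 0 < β * x * f x := by
      have := h.pos x (hmem x hx)
      positivity
    have h3 : -(C * x) ≤ |C| * x₀ := by
      calc -(C * x) = -C * x := by ring
        _ ≤ |C| * x := by have := neg_le_abs C; gcongr
        _ ≤ |C| * x₀ := by have := hx.2.le; gcongr
    linarith
  have hne : (Ioo a x₀).Nonempty := nonempty_Ioo.2 hx₀.1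
  have hlim := hanti.tendsto_nhdsWithin_Ioo_right hne hbdd
  refine ⟨sSup (deriv (Fm m f) '' Ioo a x₀), ?_, ?_⟩
  · obtain ⟨z, hz⟩ := hne
    exact (h.flux_pos_of_lt hm hβ hκ.le hx₀' hD₀.le z hz).trans_le
      (le_csSup hbdd (mem_image_of_mem _ hz))
  · refine hasDerivWithinAt_Ici_of_tendsto_deriv (s := Ioo a x₀)
      (fun x hx => (h.hasDerivAt_pow (hmem x hx)).differentiableAt.differentiableWithinAt)
      ((hcF a ⟨le_rfl, hab⟩).mono fun x hx => ⟨hx.1.le, (hmem x hx).2⟩)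
      (Ioo_mem_nhdsGT hx₀.1) hlim

end IsReactionDominated

lemma SolvesODE.isReactionDominated {m p σ α β κ M a b : ℝ} {f : ℝ → ℝ} (ha : 0 ≤ a)
    (hm : m ≠ 0) (hp1 : p ≤ 1) (hσ : 0 ≤ σ) (hα : 0 ≤ α) (hβ : 0 < β) (hκ : 0 < κ)
    (haκ : 2 * κ ≤ a ^ σ) (hMκ : (α + β) * M ^ (1 - p) ≤ κ) (hc : ContinuousOn f (Ioo a b))
    (hpos : ∀ x ∈ Ioo a b, 0 < f x) (hlt : ∀ x ∈ Ioo a b, f x < M)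
    (hode : SolvesODE m p σ α β f (Ioo a b)) : IsReactionDominated m p σ α β κ f a b := by
  have hreac : ∀ x ∈ Ioo a b, (α + β) * f x + κ * f x ^ p ≤ x ^ σ * f x ^ p := by
    intro x hx
    have hfx := hpos x hx
    have hfp := Real.rpow_pos_of_pos hfx p
    have hsplit : f x ^ (1 - p) * f x ^ p = f x := by
      rw [← Real.rpow_add hfx]; norm_num
    have h1 : (α + β) * f x ^ (1 - p) ≤ κ := by
      refine le_trans ?_ hMκ
      have := Real.rpow_le_rpow hfx.le (hlt x hx).le (sub_nonneg.2 hp1)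
      gcongr
    have h2 : a ^ σ ≤ x ^ σ := Real.rpow_le_rpow ha hx.1.le hσ
    calc (α + β) * f x + κ * f x ^ p = ((α + β) * f x ^ (1 - p) + κ) * f x ^ p := by
          linear_combination -(α + β) * hsplit
      _ ≤ x ^ σ * f x ^ p := by
          refine mul_le_mul_of_nonneg_right ?_ hfp.le
          linarith
  have hne : ∀ x ∈ Ioo a b, α * f x ≠ x ^ σ * f x ^ p := by
    intro x hx heq
    have h1 := hreac x hx
    have h2 := mul_pos hβ (hpos x hx)
    have h3 := mul_pos hκ (Real.rpow_pos_of_pos (hpos x hx) p)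
    linarith
  have hreg := hode.regular ha hm hβ.ne' hc hpos hne
  exact ⟨ha, hpos, fun x hx => (hreg x hx).1, fun x hx => (hreg x hx).2, hreac⟩

/-- A priori bound for solutions with an interface at `r`, as long as they are positive. -/
lemma SolvesODE.lt_of_interface {m p σ α β κ M a r : ℝ} {f : ℝ → ℝ} (ha : 0 ≤ a) (hm : 1 < m)
    (hp1 : p ≤ 1) (hmp : 2 < m + p) (hσ : 0 ≤ σ) (hα : 0 ≤ α) (hβ : 0 < β) (hκ : 0 < κ)
    (hM : 0 < M) (haκ : 2 * κ ≤ a ^ σ) (hMκ : (α + β) * M ^ (1 - p) ≤ κ)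
    (hMr : (β * r) ^ 2 * (m + p - 1) < κ * m * M ^ (m + p - 2))
    (hc : ContinuousOn f (Ioc a r)) (hpos : ∀ x ∈ Ioo a r, 0 < f x)
    (hode : SolvesODE m p σ α β f (Ioo a r)) (hfr : f r = 0)
    (hF : HasDerivWithinAt (Fm m f) 0 (Iic r) r) : ∀ x ∈ Ioo a r, f x < M := by
  intro x₁ hx₁
  by_contra! hge
  have hm0 : 0 < m := by linarith
  have hcI : ContinuousOn f (Icc x₁ r) := hc.mono fun x hx => ⟨hx₁.1.trans_le hx.1, hx.2⟩
  have hcompact : IsCompact (Icc x₁ r ∩ f ⁻¹' Ici M) :=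
    isCompact_Icc.of_isClosed_subset (hcI.preimage_isClosed_of_isClosed isClosed_Icc isClosed_Ici)
      inter_subset_left
  obtain ⟨s, ⟨⟨hx₁s, hsr⟩, hsM⟩, hsmax⟩ := hcompact.exists_isGreatest
    ⟨x₁, ⟨le_rfl, hx₁.2.le⟩, hge⟩
  replace hsM : M ≤ f s := hsM
  have hsr' : s < r := by
    refine lt_of_le_of_ne hsr fun h => ?_
    rw [h, hfr] at hsM
    linarith
  have has : a < s := hx₁.1.trans_le hx₁s
  have hr : 0 < r := (ha.trans_lt has).trans hsr'
  have hlt : ∀ x ∈ Ioo s r, f x < M := by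
    intro x hx
    by_contra! h
    exact absurd (hsmax ⟨⟨hx₁s.trans hx.1.le, hx.2.le⟩, h⟩) (not_le.2 hx.1)
  have hsub : Ioo s r ⊆ Ioo a r := Ioo_subset_Ioo_left has.le
  have h : IsReactionDominated m p σ α β κ f s r :=
    SolvesODE.isReactionDominated (ha.trans has.le) hm0.ne' hp1 hσ hα hβ hκ
      (haκ.trans (Real.rpow_le_rpow ha has.le hσ)) hMκ
      (hc.mono fun x hx => ⟨(hsub hx).1, hx.2.le⟩) (fun x hx => hpos x (hsub hx)) hlt
      fun x hx => hode x (hsub hx)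
  have hf0 : Tendsto f (𝓝[<] r) (𝓝 0) := by
    have h1 : ContinuousWithinAt f (Ioo a r) r :=
      (hc r ⟨hx₁.1.trans hx₁.2, le_rfl⟩).mono Ioo_subset_Ioc_self
    have h2 := h1.tendsto
    rwa [nhdsWithin_Ioo_eq_nhdsLT (hx₁.1.trans hx₁.2), hfr] at h2
  have hfs : Tendsto f (𝓝[>] s) (𝓝 (f s)) :=
    (hc.continuousAt (Ioc_mem_nhds has hsr')).tendsto.mono_left nhdsWithin_le_nhds
  have hD : ∀ x ∈ Ioo s r, deriv (Fm m f) x ≤ 0 := by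
    intro x hx
    by_contra! hDx
    have hmono : StrictMonoOn f (Icc s x) := by
      refine strictMonoOn_of_deriv_pos (convex_Icc s x)
        (hc.mono fun z hz => ⟨has.trans_le hz.1, hz.2.trans hx.2.le⟩) fun z hz => ?_
      rw [interior_Icc] at hz
      have hz' : z ∈ Ioo s r := ⟨hz.1, hz.2.trans hx.2⟩
      have hDz := h.flux_pos_of_lt hm0 hβ hκ.le hx hDx.le z hz
      rw [h.deriv_Fm hz'] at hDz
      exact pos_of_mul_pos_left hDz (h.factor_pos hm0 hz').le
    have h1 := hmono ⟨le_rfl, hx.1.le⟩ ⟨hx.1.le, le_rfl⟩ hx.1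
    linarith [hlt x hx]
  have hbound := h.pow_le_of_flux_nonpos hm0 (by linarith) hβ hκ hF hf0 hD
  have hlim : κ * m / ((m + p - 1) * (β * r)) * f s ^ (m + p - 1) ≤ β * r * f s := by
    refine le_of_tendsto_of_tendsto
      ((hfs.rpow_const (Or.inr (by linarith))).const_mul _) (hfs.const_mul _) ?_
    filter_upwards [Ioo_mem_nhdsGT hsr'] with z hz using hbound z hz
  have hfspos : 0 < f s := hM.trans_le hsM
  have hq : 0 < m + p - 1 := by linarith
  have hB : 0 < β * r := mul_pos hβ hr
  have hsplit : f s ^ (m + p - 1) = f s ^ (m + p - 2) * f s := by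
    rw [← Real.rpow_add_one hfspos.ne']; ring_nf
  rw [hsplit, ← mul_assoc] at hlim
  have h1 := le_of_mul_le_mul_right hlim hfspos
  have h2 : M ^ (m + p - 2) ≤ f s ^ (m + p - 2) :=
    Real.rpow_le_rpow hM.le hsM (by linarith)
  rw [div_mul_eq_mul_div, div_le_iff₀ (by positivity)] at h1
  have h3 : κ * m * M ^ (m + p - 2) ≤ κ * m * f s ^ (m + p - 2) := by gcongr
  nlinarith

/-- Admissible thresholds for large interface points. -/
lemma exists_threshold {m p σ α β : ℝ} (hm : 1 < m) (hp0 : 0 < p) (hp1 : p < 1)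
    (hσ : 2 * (1 - p) / (m - 1) < σ) :
    ∃ Xi : ℝ, 0 < Xi ∧ ∀ r : ℝ, Xi < r → ∃ M κ : ℝ, 0 < M ∧ 0 < κ ∧ 2 * κ ≤ (r / 4) ^ σ ∧
      (α + β) * M ^ (1 - p) ≤ κ ∧ (β * r) ^ 2 * (m + p - 1) < κ * m * M ^ (m + p - 2) ∧
      β * r * M ^ (1 - p) < (1 - p) * κ * (r / 4) ∧
      M ^ (m - p) < (1 - p / m) * κ * (r / 8) * (r / 16) := by
  set k := σ - 2 * (1 - p) / (m - 1) with hk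
  have hkpos : 0 < k := sub_pos.2 hσ
  have hm1 : 0 < m - 1 := by linarith
  set c : ℝ := 1 / (2 * 4 ^ σ) with hc
  have hcpos : 0 < c := by positivity
  have hθ : 0 < 1 - p / m := sub_pos.2 ((div_lt_one (by linarith)).2 (by linarith))
  have hp' : 0 < 1 - p := by linarith
  have hlarge : ∀ C : ℝ, ∀ᶠ r : ℝ in atTop, C < r ^ k := fun C =>
    (tendsto_rpow_atTop hkpos).eventually_gt_atTop C
  obtain ⟨X, hX⟩ := eventually_atTop.1 ((hlarge ((α + β) / c)).and
    ((hlarge (β ^ 2 * (m + p - 1) / (c * m))).and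
    ((hlarge (4 * β / ((1 - p) * c))).and (hlarge (128 / ((1 - p / m) * c))))))
  refine ⟨max X 1, by positivity, fun r hr => ?_⟩
  have hr0 : 0 < r := by linarith [le_max_right X 1]
  obtain ⟨h1, h2, h3, h4⟩ := hX r ((le_max_left X 1).trans hr.le)
  rw [div_lt_iff₀ (by positivity)] at h1 h2 h3 h4
  set T := r ^ k with hT
  set A := r ^ (2 * (1 - p) / (m - 1)) with hA
  have hApos : 0 < A := Real.rpow_pos_of_pos hr0 _
  have hTA : r ^ σ = T * A := by
    rw [hT, hA, ← Real.rpow_add hr0]; congr 1; ring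
  have hM1 : (r ^ (2 / (m - 1))) ^ (1 - p) = A := by
    rw [← Real.rpow_mul hr0.le, hA]; congr 1; ring
  have hM2 : (r ^ (2 / (m - 1))) ^ (m + p - 2) * A = r ^ 2 := by
    rw [← Real.rpow_mul hr0.le, hA, ← Real.rpow_add hr0, ← Real.rpow_natCast]
    congr 1
    field_simp
    push_cast
    ring
  have hM3 : (r ^ (2 / (m - 1))) ^ (m - p) = r ^ 2 * A := by
    rw [← Real.rpow_mul hr0.le, hA, ← Real.rpow_natCast, ← Real.rpow_add hr0]
    congr 1
    field_simp
    push_cast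
    ring
  refine ⟨r ^ (2 / (m - 1)), c * (T * A), Real.rpow_pos_of_pos hr0 _, by positivity, ?_, ?_, ?_,
    ?_, ?_⟩
  · rw [Real.div_rpow hr0.le (by norm_num), hTA, hc]
    apply le_of_eq
    field_simp
  · rw [hM1]
    nlinarith
  · have : c * (T * A) * m * (r ^ (2 / (m - 1))) ^ (m + p - 2) = T * (c * m) * r ^ 2 := by
      rw [← hM2]; ring
    rw [this]
    nlinarith [mul_lt_mul_of_pos_right h2 (pow_pos hr0 2)]
  · rw [hM1]
    nlinarith [mul_lt_mul_of_pos_right h3 (mul_pos hr0 hApos)]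
  · rw [hM3]
    nlinarith [mul_lt_mul_of_pos_right h4 (mul_pos (pow_pos hr0 2) hApos)]

/-- A continuous function that is positive near `r` and vanishes somewhere in `(a, r)` has a last
zero before `r`. -/
lemma exists_last_zero {f : ℝ → ℝ} {a r : ℝ} (hc : ContinuousOn f (Icc a r))
    (hnn : ∀ x ∈ Icc a r, 0 ≤ f x) (hr : ∃ δ > 0, ∀ x ∈ Ioo (r - δ) r, 0 < f x)
    (hz : ∃ x ∈ Ioo a r, f x = 0) :
    ∃ x₁ ∈ Ioo a r, f x₁ = 0 ∧ ∀ x ∈ Ioo x₁ r, 0 < f x := by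
  obtain ⟨δ, hδ, hpos⟩ := hr
  obtain ⟨z, hz, hfz⟩ := hz
  have hzle : ∀ x ∈ Ioo a r, f x = 0 → x ≤ r - δ := fun x hx hfx => by
    by_contra! h
    exact (hpos x ⟨h, hx.2⟩).ne' hfx
  have hcompact : IsCompact (Icc z (r - δ) ∩ f ⁻¹' {0}) :=
    isCompact_Icc.of_isClosed_subset ((hc.mono (Icc_subset_Icc hz.1.le
      (by linarith))).preimage_isClosed_of_isClosed isClosed_Icc isClosed_singleton)
      inter_subset_left
  obtain ⟨s, ⟨⟨hzs, hsr⟩, hfs⟩, hsmax⟩ := hcompact.exists_isGreatest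
    ⟨z, ⟨le_rfl, hzle z hz hfz⟩, hfz⟩
  have has : a < s := hz.1.trans_le hzs
  refine ⟨s, ⟨has, by linarith⟩, hfs, fun x hx => ?_⟩
  refine (hnn x ⟨(has.trans hx.1).le, hx.2.le⟩).lt_of_ne' fun hfx => ?_
  exact absurd (hsmax ⟨⟨hzs.trans hx.1.le, hzle x ⟨has.trans hx.1, hx.2⟩ hfx⟩, hfx⟩)
    (not_le.2 hx.1)

/-- for interface points `ξ₀` large enough, the solution with an
interface of Type I at `ξ₀`, extended backward on its maximal interval of
positivity, has a backward change of sign at some `ξ₁ ∈ (0,ξ₀)`: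
`f(ξ₁) = 0`, `(f^m)'(ξ₁⁺) > 0`, and `f > 0` on `(ξ₁,ξ₀)`. -/
theorem profiles_with_large_interface_point_change_sign (m p σ α β : ℝ)
    (hm : 1 < m) (hp0 : 0 < p) (hp1 : p < 1) (hmp : 2 < m + p)
    (hσ : 2 * (1 - p) / (m - 1) < σ)
    (hα : α = (σ + 2) / (σ * (m - 1) + 2 * (p - 1)))
    (hβ : β = (m - p) / (σ * (m - 1) + 2 * (p - 1))) :
    ∃ Xi : ℝ, 0 < Xi ∧ ∀ ξ₀ : ℝ, Xi < ξ₀ →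
      ∀ f : ℝ → ℝ,
        ContinuousOn f (Set.Icc 0 ξ₀) →
        (∀ ξ ∈ Set.Icc 0 ξ₀, 0 ≤ f ξ) →
        SolvesODE m p σ α β f {ξ : ℝ | ξ ∈ Set.Ioo 0 ξ₀ ∧ 0 < f ξ} →
        f ξ₀ = 0 →
        HasDerivWithinAt (Fm m f) 0 (Set.Iic ξ₀) ξ₀ →
        (∃ δ > 0, ∀ ξ ∈ Set.Ioo (ξ₀ - δ) ξ₀, 0 < f ξ) →
        TypeI m f ξ₀ →
        ∃ ξ₁ ∈ Set.Ioo 0 ξ₀, f ξ₁ = 0 ∧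
          (∃ d > (0 : ℝ), HasDerivWithinAt (Fm m f) d (Set.Ici ξ₁) ξ₁) ∧
          ∀ ξ ∈ Set.Ioo ξ₁ ξ₀, 0 < f ξ := by
  have hm1 : 0 < m - 1 := by linarith
  have hσ0 : 0 < σ := (by have := sub_pos.2 hp1; positivity : 0 ≤ 2 * (1 - p) / (m - 1)).trans_lt hσ
  have hden : 0 < σ * (m - 1) + 2 * (p - 1) := by
    rw [div_lt_iff₀ hm1] at hσ
    linarith
  have hα0 : 0 ≤ α := hα ▸ div_nonneg (by linarith) hden.le
  have hβ0 : 0 < β := hβ ▸ div_pos (by linarith) hden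
  have hm0 : 0 < m := by linarith
  obtain ⟨Xi, hXi, hthr⟩ := exists_threshold (α := α) (β := β) hm hp0 hp1 hσ
  refine ⟨Xi, hXi, fun r hr f hc hnn hode hfr hF hnear _ => ?_⟩
  obtain ⟨M, κ, hM, hκ, hrκ, hMκ, hMr, hflux, htime⟩ := hthr r hr
  have hr0 : 0 < r := hXi.trans hr
  have hreg : ∀ a, r / 4 ≤ a → a < r → (∀ x ∈ Ioo a r, 0 < f x) →
      IsReactionDominated m p σ α β κ f a r ∧ ∀ x ∈ Ioo a r, f x < M := by
    intro a har hlt hpos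
    have ha : 0 ≤ a := by linarith
    have haκ : 2 * κ ≤ a ^ σ := hrκ.trans (Real.rpow_le_rpow (by linarith) har hσ0.le)
    have hode' : SolvesODE m p σ α β f (Ioo a r) := fun x hx =>
      hode x ⟨⟨ha.trans_lt hx.1, hx.2⟩, hpos x hx⟩
    have hbound := hode'.lt_of_interface ha hm hp1.le hmp hσ0.le hα0 hβ0 hκ hM haκ hMκ hMr
      (hc.mono fun x hx => ⟨ha.trans hx.1.le, hx.2⟩) hpos hfr hF
    exact ⟨hode'.isReactionDominated ha hm0.ne' hp1.le hσ0.le hα0 hβ0 hκ haκ hMκ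
      (hc.mono fun x hx => ⟨ha.trans hx.1.le, hx.2.le⟩) hpos hbound, hbound⟩
  have hsub : Icc (r / 4) r ⊆ Icc 0 r := Icc_subset_Icc_left (by linarith)
  have hzero : ∃ x ∈ Ioo (r / 4) r, f x = 0 := by
    by_contra! hne
    have hpos : ∀ x ∈ Ioo (r / 4) r, 0 < f x := fun x hx =>
      (hnn x (hsub (Ioo_subset_Icc_self hx))).lt_of_ne' (hne x hx)
    obtain ⟨h, hlt⟩ := hreg (r / 4) le_rfl (by linarith) hpos
    have hf0 : Tendsto f (𝓝[<] r) (𝓝 0) := by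
      have h1 := ((hc r ⟨hr0.le, le_rfl⟩).mono Ioo_subset_Icc_self).tendsto
      rwa [nhdsWithin_Ioo_eq_nhdsLT hr0, hfr] at h1
    obtain ⟨x₀, hx₀, hD⟩ := h.exists_flux_nonneg hp0.le hp1 hβ0 hκ hlt hF hf0
      (s := r / 2) (t := 3 * r / 4) (by linarith) (by linarith) (by linarith) (by
        rw [show 3 * r / 4 - r / 2 = r / 4 by ring]; exact hflux)
    have hle := h.backward_time_le hm0 hp0.le (by linarith) hβ0 hκ (x := 3 * r / 8)
      (y := 7 * r / 16) hlt
      (hc.mono (Icc_subset_Icc (by linarith) (by linarith [hx₀.2])))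
      (hnn _ ⟨by linarith, by linarith⟩) ⟨by linarith [hx₀.1], by linarith [hx₀.2]⟩ hD
      (by linarith) (by linarith) (by linarith [hx₀.1])
    rw [show 3 * r / 8 - r / 4 = r / 8 by ring, show 7 * r / 16 - 3 * r / 8 = r / 16 by ring] at hle
    linarith
  obtain ⟨x₁, hx₁, hfx₁, hpos⟩ := exists_last_zero (hc.mono hsub) (fun x hx => hnn x (hsub hx))
    hnear hzero
  obtain ⟨h, -⟩ := hreg x₁ hx₁.1.le hx₁.2 hpos
  have hx₁0 : 0 < x₁ := by linarith [hx₁.1]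
  exact ⟨x₁, ⟨hx₁0, hx₁.2⟩, hfx₁, h.exists_pos_hasDerivWithinAt hm0 hp0.le hσ0.le hα0 hβ0 hκ hx₁.2
    (hc.mono fun x hx => ⟨hx₁0.le.trans hx.1, hx.2.le⟩) hfx₁, hpos⟩
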